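/- arXiv:1010.3398 — 3 statements merged into one kernel-verified Lean document; each statement's English description precedes it below -/
import Mathlib

section
/- Let A be a local algebra in the sense of André Weil with maximal ideal 𝔪, and let ann(𝔪) = {a ∈ A : a·x = 0 for all x ∈ 𝔪}. Let μ_A : A × A → A, (a,b) ↦ a·b, be the multiplication of A. Then there exists a real linear form ψ : A → ℝ such that the symmetric bilinear form ψ ∘ μ_A : A × A → ℝ, (a,b) ↦ ψ(a·b), is nondegenerate if and only if dim_ℝ ann(𝔪) = 1. -/
/-- The annihilator `ann(𝔪) = {a ∈ A : a·x = 0 for all x ∈ 𝔪}` of the maximal ideal of a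
local real algebra, viewed as a real subspace of `A`. -/
def annMaximalIdeal (A : Type*) [CommRing A] [Algebra ℝ A] [IsLocalRing A] :
    Submodule ℝ A where
  carrier := {a : A | ∀ x ∈ IsLocalRing.maximalIdeal A, a * x = 0}
  add_mem' {a b} ha hb x hx := by rw [add_mul, ha x hx, hb x hx, add_zero]
  zero_mem' x hx := zero_mul x
  smul_mem' r a ha x hx := by rw [smul_mul_assoc, ha x hx, smul_zero]

open IsLocalRing in
/-- A local real algebra with residue field `ℝ` splits as `ℝ ⊕ 𝔪`. -/
theorem exists_sub_smul_one_mem_maximalIdeal {A : Type*} [CommRing A] [Algebra ℝ A]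
    [IsLocalRing A] (hcodim : Module.finrank ℝ (A ⧸ maximalIdeal A) = 1) (a : A) :
    ∃ r : ℝ, a - r • (1 : A) ∈ maximalIdeal A := by
  have hone : Ideal.Quotient.mk (maximalIdeal A) 1 ≠ 0 := by
    rw [Ne, Ideal.Quotient.eq_zero_iff_mem]
    exact (Ideal.ne_top_iff_one _).mp (maximalIdeal.isMaximal A).ne_top
  obtain ⟨r, hr⟩ := (finrank_eq_one_iff_of_nonzero' _ hone).mp hcodim
    (Ideal.Quotient.mk (maximalIdeal A) a)
  refine ⟨r, ?_⟩
  rw [← Ideal.Quotient.eq, ← hr]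
  rfl

open IsLocalRing in
/-- In a finite-dimensional local algebra, every nonzero element has a nonzero multiple in
`ann(𝔪)`. -/
theorem exists_mul_mem_annMaximalIdeal {A : Type*} [CommRing A] [Algebra ℝ A]
    [IsLocalRing A] [FiniteDimensional ℝ A] {a : A} (ha : a ≠ 0) :
    ∃ b : A, a * b ∈ annMaximalIdeal A ∧ a * b ≠ 0 := by
  classical
  have : IsArtinianRing A := IsArtinianRing.of_finite ℝ A
  obtain ⟨n, hn⟩ : IsNilpotent (maximalIdeal A) := by
    rw [← jacobson_eq_maximalIdeal ⊥ bot_ne_top]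
    exact IsArtinianRing.isNilpotent_jacobson_bot
  have hex : ∃ k, ∀ x ∈ maximalIdeal A ^ k, a * x = 0 := by
    refine ⟨n, fun x hx => ?_⟩
    rw [hn] at hx
    rw [(Submodule.mem_bot A).mp hx, mul_zero]
  obtain ⟨j, hj⟩ : ∃ j, Nat.find hex = j + 1 := by
    refine Nat.exists_eq_succ_of_ne_zero fun h => ha ?_
    have h0 := Nat.find_spec hex
    rw [h, pow_zero, Ideal.one_eq_top] at h0
    simpa using h0 1 Submodule.mem_top
  have hmin := Nat.find_min hex (m := j) (by omega)
  push Not at hmin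
  obtain ⟨b, hb, hab⟩ := hmin
  refine ⟨b, fun x hx => ?_, hab⟩
  rw [mul_assoc]
  refine Nat.find_spec hex _ ?_
  rw [hj, pow_succ]
  exact Ideal.mul_mem_mul hb hx

/-- Let `A` be a local algebra in the sense of André Weil with maximal
ideal `𝔪`, and let `ann(𝔪) = {a ∈ A : a·x = 0 for all x ∈ 𝔪}`. Then there exists a real
linear form `ψ : A → ℝ` such that the symmetric bilinear form `(a, b) ↦ ψ(a·b)` is
nondegenerate if and only if `dim_ℝ ann(𝔪) = 1`. -/
theorem weil_algebra_exists_nondegenerate_iff (A : Type*) [CommRing A] [Algebra ℝ A]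
    [IsLocalRing A] [FiniteDimensional ℝ A]
    (hcodim : Module.finrank ℝ (A ⧸ IsLocalRing.maximalIdeal A) = 1) :
    (∃ ψ : A →ₗ[ℝ] ℝ, ∀ a : A, (∀ b : A, ψ (a * b) = 0) → a = 0) ↔
      Module.finrank ℝ (annMaximalIdeal A) = 1 := by
  constructor
  · rintro ⟨ψ, hψ⟩
    have hinj : Function.Injective (ψ ∘ₗ (annMaximalIdeal A).subtype) := by
      rw [← LinearMap.ker_eq_bot, LinearMap.ker_eq_bot']
      rintro ⟨a, ha⟩ h
      replace h : ψ a = 0 := h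
      refine Subtype.ext (hψ a fun b => ?_)
      obtain ⟨r, hr⟩ := exists_sub_smul_one_mem_maximalIdeal hcodim b
      have hab : a * b = r • a := by
        simpa [mul_sub, sub_eq_zero] using ha _ hr
      rw [hab, map_smul, h, smul_zero]
    have hle := LinearMap.finrank_le_finrank_of_injective hinj
    rw [Module.finrank_self] at hle
    obtain ⟨b, hb, hb0⟩ := exists_mul_mem_annMaximalIdeal (one_ne_zero (α := A))
    have : Nontrivial (annMaximalIdeal A) :=
      ⟨⟨⟨_, hb⟩, 0, fun h => hb0 (congrArg Subtype.val h)⟩⟩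
    exact le_antisymm hle Module.finrank_pos
  · intro h
    obtain ⟨v, hv, hspan⟩ := finrank_eq_one_iff'.mp h
    have hv0 : (v : A) ≠ 0 := fun h => hv (Subtype.ext h)
    obtain ⟨ψ, hψ⟩ : ∃ ψ : Module.Dual ℝ A, ψ v ≠ 0 := by
      by_contra! hall
      exact hv0 ((Module.forall_dual_apply_eq_zero_iff ℝ (v : A)).mp hall)
    refine ⟨ψ, fun a ha => ?_⟩
    by_contra ha0
    obtain ⟨b, hb, hb0⟩ := exists_mul_mem_annMaximalIdeal ha0
    obtain ⟨c, hc⟩ := hspan ⟨_, hb⟩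
    replace hc : c • (v : A) = a * b := congrArg Subtype.val hc
    have hzero := ha b
    rw [← hc, map_smul, smul_eq_mul, mul_eq_zero, or_iff_left hψ] at hzero
    exact hb0 (by rw [← hc, hzero, zero_smul])
end

section
/- Let s ≥ 1 and k_1, …, k_s ≥ 1 be integers, and let A = ℝ[T_1, …, T_s]/(T_1^{k_1}, …, T_s^{k_s}) be the quotient of the real polynomial algebra in s variables by the ideal generated by T_1^{k_1}, …, T_s^{k_s}. Then A is a local algebra in the sense of André Weil, its maximal ideal 𝔪 is generated by the classes of T_1, …, T_s, and the annihilator ann(𝔪) = {a ∈ A : a·x = 0 for all x ∈ 𝔪} is a one-dimensional real vector space, spanned by the class of T_1^{k_1−1}·…·T_s^{k_s−1}. -/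
set_option synthInstance.maxHeartbeats 1000000
set_option maxHeartbeats 1000000
open MvPolynomial

/-- The ideal `(T_1^{k_1}, …, T_s^{k_s})` of `ℝ[T_1, …, T_s]`. -/
noncomputable def truncIdeal (s : ℕ) (k : Fin s → ℕ) : Ideal (MvPolynomial (Fin s) ℝ) :=
  Ideal.span (Set.range fun i => X i ^ k i)

/-- The truncated polynomial algebra `A = ℝ[T_1, …, T_s]/(T_1^{k_1}, …, T_s^{k_s})`. -/
abbrev TruncAlg (s : ℕ) (k : Fin s → ℕ) : Type :=
  MvPolynomial (Fin s) ℝ ⧸ truncIdeal s k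

/-- The ideal of `A = ℝ[T_1, …, T_s]/(T_1^{k_1}, …, T_s^{k_s})` generated by the classes
of `T_1, …, T_s`. -/
noncomputable def truncMaxIdeal (s : ℕ) (k : Fin s → ℕ) : Ideal (TruncAlg s k) :=
  Ideal.span (Set.range fun i => Ideal.Quotient.mk (truncIdeal s k) (X i))

/-- The annihilator `{a ∈ A : a·x = 0 for all x ∈ 𝔪}` of the ideal `𝔪` generated by the
classes of `T_1, …, T_s`, as a real subspace of `A`. -/
noncomputable def truncAnn (s : ℕ) (k : Fin s → ℕ) : Submodule ℝ (TruncAlg s k) where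
  carrier := {a : TruncAlg s k | ∀ x ∈ truncMaxIdeal s k, a * x = 0}
  add_mem' {a b} ha hb x hx := by rw [add_mul, ha x hx, hb x hx, add_zero]
  zero_mem' x hx := zero_mul x
  smul_mem' r a ha x hx := by rw [smul_mul_assoc, ha x hx, smul_zero]

theorem mem_truncIdeal_iff {s : ℕ} {k : Fin s → ℕ} {f : MvPolynomial (Fin s) ℝ} :
    f ∈ truncIdeal s k ↔ ∀ d, (∀ i, d i < k i) → coeff d f = 0 := by
  have h : truncIdeal s k = Ideal.span ((fun d => monomial d (1 : ℝ)) ''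
      Set.range fun i => Finsupp.single i (k i)) := by
    rw [truncIdeal, ← Set.range_comp]
    simp only [Function.comp_def, X_pow_eq_monomial]
  rw [h, mem_ideal_span_monomial_image]
  refine forall_congr' fun d => ?_
  rw [mem_support_iff, not_imp_comm]
  simp [Finsupp.single_le_iff]

theorem X_pow_mem_truncIdeal {s : ℕ} (k : Fin s → ℕ) (i : Fin s) :
    X i ^ k i ∈ truncIdeal s k :=
  Ideal.subset_span ⟨i, rfl⟩

theorem X_mul_mem_truncIdeal_iff {s : ℕ} {k : Fin s → ℕ} {f : MvPolynomial (Fin s) ℝ}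
    {i : Fin s} :
    X i * f ∈ truncIdeal s k ↔
      ∀ d, (∀ j, (Finsupp.single i 1 + d : Fin s →₀ ℕ) j < k j) → coeff d f = 0 := by
  refine mem_truncIdeal_iff.trans ⟨fun h d hd => ?_, fun h d hd => ?_⟩
  · rw [← coeff_X_mul d i f]
    exact h _ hd
  · rw [coeff_X_mul']
    split_ifs with hi
    · have e : Finsupp.single i 1 + (d - Finsupp.single i 1) = d :=
        add_tsub_cancel_of_le (Finsupp.single_le_iff.2
          (Nat.one_le_iff_ne_zero.2 (Finsupp.mem_support_iff.1 hi)))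
      exact h _ (by rwa [e])
    · rfl

/-- Evaluation at the origin, as an algebra homomorphism from the truncated polynomial algebra
to `ℝ`. -/
noncomputable def truncAug {s : ℕ} {k : Fin s → ℕ} (hk : ∀ i, 1 ≤ k i) :
    TruncAlg s k →ₐ[ℝ] ℝ :=
  Ideal.Quotient.liftₐ (truncIdeal s k) (aeval (0 : Fin s → ℝ)) fun f hf =>
    (aeval_zero' f).trans (mem_truncIdeal_iff.1 hf 0 hk)

theorem truncAug_mk {s : ℕ} {k : Fin s → ℕ} (hk : ∀ i, 1 ≤ k i) (f : MvPolynomial (Fin s) ℝ) :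
    truncAug hk (Ideal.Quotient.mk (truncIdeal s k) f) = constantCoeff f :=
  aeval_zero' f

theorem truncAug_surjective {s : ℕ} {k : Fin s → ℕ} (hk : ∀ i, 1 ≤ k i) :
    Function.Surjective (truncAug hk) := fun r =>
  ⟨algebraMap ℝ _ r, (truncAug hk).commutes r⟩

theorem ker_truncAug {s : ℕ} {k : Fin s → ℕ} (hk : ∀ i, 1 ≤ k i) :
    RingHom.ker (truncAug hk) = truncMaxIdeal s k := by
  apply le_antisymm
  · intro a ha
    obtain ⟨f, rfl⟩ := Ideal.Quotient.mk_surjective a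
    rw [RingHom.mem_ker, truncAug_mk, constantCoeff_eq] at ha
    have hf : f ∈ idealOfVars (Fin s) ℝ := by
      rw [← pow_one (idealOfVars (Fin s) ℝ), mem_pow_idealOfVars_iff']
      intro d hd
      rwa [(Finsupp.degree_eq_zero_iff d).1 (Nat.lt_one_iff.1 hd)]
    have h := Ideal.mem_map_of_mem (Ideal.Quotient.mk (truncIdeal s k)) hf
    rwa [Ideal.map_span, ← Set.range_comp] at h
  · rw [truncMaxIdeal, Ideal.span_le]
    rintro _ ⟨i, rfl⟩
    exact (truncAug_mk hk _).trans (constantCoeff_X _ i)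

theorem truncMaxIdeal_isMaximal {s : ℕ} {k : Fin s → ℕ} (hk : ∀ i, 1 ≤ k i) :
    (truncMaxIdeal s k).IsMaximal :=
  ker_truncAug hk ▸ RingHom.ker_isMaximal_of_surjective _ (truncAug_surjective hk)

theorem truncMaxIdeal_le_of_isPrime {s : ℕ} {k : Fin s → ℕ} (J : Ideal (TruncAlg s k))
    (hJ : J.IsPrime) : truncMaxIdeal s k ≤ J := by
  rw [truncMaxIdeal, Ideal.span_le]
  rintro _ ⟨i, rfl⟩
  refine hJ.mem_of_pow_mem (k i) ?_
  rw [← map_pow, Ideal.Quotient.eq_zero_iff_mem.2 (X_pow_mem_truncIdeal k i)]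
  exact J.zero_mem

theorem eq_truncMaxIdeal_of_isMaximal {s : ℕ} {k : Fin s → ℕ} (hk : ∀ i, 1 ≤ k i)
    (J : Ideal (TruncAlg s k)) (hJ : J.IsMaximal) : J = truncMaxIdeal s k :=
  ((truncMaxIdeal_isMaximal hk).eq_of_le hJ.ne_top
    (truncMaxIdeal_le_of_isPrime J hJ.isPrime)).symm

theorem finrank_quotient_truncMaxIdeal {s : ℕ} {k : Fin s → ℕ} (hk : ∀ i, 1 ≤ k i) :
    Module.finrank ℝ (TruncAlg s k ⧸ truncMaxIdeal s k) = 1 := by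
  rw [← ker_truncAug hk, (Ideal.quotientKerAlgEquivOfSurjective
    (truncAug_surjective hk)).toLinearEquiv.finrank_eq, Module.finrank_self]

theorem finiteDimensional_truncAlg {s : ℕ} {k : Fin s → ℕ} (hk : ∀ i, 1 ≤ k i) :
    FiniteDimensional ℝ (TruncAlg s k) := by
  have hint : ∀ x ∈ Set.range fun i => Ideal.Quotient.mkₐ ℝ (truncIdeal s k) (X i),
      IsIntegral ℝ x := by
    rintro _ ⟨i, rfl⟩
    refine IsIntegral.of_pow (hk i) ?_
    rw [← map_pow, Ideal.Quotient.mkₐ_eq_mk,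
      Ideal.Quotient.eq_zero_iff_mem.2 (X_pow_mem_truncIdeal k i)]
    exact isIntegral_zero
  have htop : Algebra.adjoin ℝ
      (Set.range fun i => Ideal.Quotient.mkₐ ℝ (truncIdeal s k) (X i)) = ⊤ := by
    have h := (Ideal.Quotient.mkₐ ℝ (truncIdeal s k)).map_adjoin (Set.range X)
    rw [adjoin_range_X, Algebra.map_top, ← Set.range_comp,
      (AlgHom.range_eq_top _).2 (Ideal.Quotient.mkₐ_surjective ℝ _)] at h
    exact h.symm
  have h := fg_adjoin_of_finite (Set.finite_range _) hint
  rw [htop, Algebra.top_toSubmodule] at h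
  exact ⟨h⟩

theorem mk_mem_truncAnn_iff {s : ℕ} {k : Fin s → ℕ} {f : MvPolynomial (Fin s) ℝ} :
    Ideal.Quotient.mk (truncIdeal s k) f ∈ truncAnn s k ↔
      ∀ i, X i * f ∈ truncIdeal s k := by
  have h : Ideal.Quotient.mk (truncIdeal s k) f ∈ truncAnn s k ↔
      truncMaxIdeal s k ≤ LinearMap.ker
        (LinearMap.mulLeft (TruncAlg s k) (Ideal.Quotient.mk (truncIdeal s k) f)) := Iff.rfl
  rw [h, truncMaxIdeal, Ideal.span, Submodule.span_le, Set.range_subset_iff]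
  refine forall_congr' fun i => ?_
  rw [SetLike.mem_coe, LinearMap.mem_ker, LinearMap.mulLeft_apply, ← map_mul,
    Ideal.Quotient.eq_zero_iff_mem, mul_comm]

theorem coeff_prod_X_pow {s : ℕ} (e : Fin s → ℕ) (d : Fin s →₀ ℕ) :
    coeff d (∏ i, X i ^ e i : MvPolynomial (Fin s) ℝ) = if ⇑d = e then 1 else 0 := by
  have h : (∏ i, X i ^ e i : MvPolynomial (Fin s) ℝ) =
      monomial (Finsupp.equivFunOnFinite.symm e) 1 := by
    rw [monomial_eq, C_1, one_mul, Finsupp.prod_fintype _ _ fun i => pow_zero _]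
    rfl
  rw [h, coeff_monomial]
  refine if_congr ?_ rfl rfl
  rw [DFunLike.ext'_iff, eq_comm]
  rfl

theorem truncAnn_eq_span {s : ℕ} {k : Fin s → ℕ} (hk : ∀ i, 1 ≤ k i) :
    truncAnn s k = Submodule.span ℝ
      {Ideal.Quotient.mk (truncIdeal s k) (∏ i, X i ^ (k i - 1))} := by
  apply le_antisymm
  · intro a ha
    obtain ⟨f, rfl⟩ := Ideal.Quotient.mk_surjective a
    rw [mk_mem_truncAnn_iff] at ha
    refine Submodule.mem_span_singleton.2
      ⟨coeff (Finsupp.equivFunOnFinite.symm fun i => k i - 1) f, ?_⟩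
    rw [← Ideal.Quotient.mkₐ_eq_mk ℝ, ← map_smul, Ideal.Quotient.mkₐ_eq_mk, Ideal.Quotient.eq,
      mem_truncIdeal_iff]
    intro d hd
    rw [coeff_sub, coeff_smul, coeff_prod_X_pow]
    split_ifs with h
    · have e : d = Finsupp.equivFunOnFinite.symm fun i => k i - 1 := DFunLike.coe_injective h
      rw [e, smul_eq_mul, mul_one, sub_self]
    · obtain ⟨i, hi⟩ := Function.ne_iff.1 h
      rw [X_mul_mem_truncIdeal_iff.1 (ha i) d fun j => ?_, smul_zero, sub_zero]
      have := hd j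
      rw [Finsupp.add_apply, Finsupp.single_apply]
      split_ifs with hij
      · subst hij
        omega
      · omega
  · rw [Submodule.span_singleton_le_iff_mem, mk_mem_truncAnn_iff]
    intro i
    rw [X_mul_mem_truncIdeal_iff]
    intro d hd
    rw [coeff_prod_X_pow, if_neg]
    intro h
    have h1 := hd i
    have h2 := hk i
    rw [Finsupp.add_apply, Finsupp.single_eq_same, h] at h1
    beta_reduce at h1
    omega

theorem mk_prod_X_pow_ne_zero {s : ℕ} {k : Fin s → ℕ} (hk : ∀ i, 1 ≤ k i) :
    Ideal.Quotient.mk (truncIdeal s k) (∏ i, X i ^ (k i - 1)) ≠ 0 := by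
  rw [Ne, Ideal.Quotient.eq_zero_iff_mem, mem_truncIdeal_iff]
  intro h
  have h1 := h (Finsupp.equivFunOnFinite.symm fun i => k i - 1) fun i =>
    Nat.sub_lt (hk i) one_pos
  rw [coeff_prod_X_pow] at h1
  exact one_ne_zero ((if_pos rfl).symm.trans h1)

/-- Let `s ≥ 1` and `k_1, …, k_s ≥ 1` be integers and let
`A = ℝ[T_1, …, T_s]/(T_1^{k_1}, …, T_s^{k_s})`. Then `A` is a local algebra in the sense
of André Weil (a finite-dimensional commutative real algebra with a unique maximal ideal
of codimension `1` over `ℝ`), its maximal ideal `𝔪` is generated by the classes of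
`T_1, …, T_s`, and the annihilator `ann(𝔪) = {a ∈ A : a·x = 0 for all x ∈ 𝔪}` is a
one-dimensional real vector space spanned by the class of `T_1^{k_1-1} ⋯ T_s^{k_s-1}`. -/
theorem truncAlg_is_weil_and_ann_span (s : ℕ) (hs : 1 ≤ s) (k : Fin s → ℕ)
    (hk : ∀ i, 1 ≤ k i) :
    IsLocalRing (TruncAlg s k) ∧
    FiniteDimensional ℝ (TruncAlg s k) ∧
    (truncMaxIdeal s k).IsMaximal ∧
    (∀ J : Ideal (TruncAlg s k), J.IsMaximal → J = truncMaxIdeal s k) ∧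
    Module.finrank ℝ (TruncAlg s k ⧸ truncMaxIdeal s k) = 1 ∧
    truncAnn s k = Submodule.span ℝ
      {Ideal.Quotient.mk (truncIdeal s k) (∏ i, X i ^ (k i - 1))} ∧
    Module.finrank ℝ (truncAnn s k) = 1 := by
  refine ⟨IsLocalRing.of_unique_max_ideal ⟨_, truncMaxIdeal_isMaximal hk,
      eq_truncMaxIdeal_of_isMaximal hk⟩, finiteDimensional_truncAlg hk,
    truncMaxIdeal_isMaximal hk, eq_truncMaxIdeal_of_isMaximal hk,
    finrank_quotient_truncMaxIdeal hk, truncAnn_eq_span hk, ?_⟩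
  rw [truncAnn_eq_span hk]
  exact finrank_span_singleton (mk_prod_X_pow_ne_zero hk)
end

section
/- Let A be a local algebra in the sense of André Weil with maximal ideal 𝔪, and let C^∞(ℝ) denote the real algebra of smooth real-valued functions on ℝ. Then the map Φ from the set of ℝ-algebra homomorphisms ξ : C^∞(ℝ) → A to A, defined by Φ(ξ) = ξ(id_ℝ) where id_ℝ is the identity function on ℝ, is a bijection. (This expresses Weil's identification ℝ^A = A of the manifold of infinitely near points of ℝ of kind A with A itself.) -/
open Manifold

open scoped ContDiff in
theorem contDiff_integral_pow_mul_comp (r : ℝ) (n : ℕ) :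
    ∀ (k : ℕ) (f : ℝ → ℝ), ContDiff ℝ ∞ f →
      ContDiff ℝ n (fun x => ∫ t in (0 : ℝ)..1, t ^ k * f (r + t * (x - r))) := by
  induction n with
  | zero =>
    intro k f hf
    have hc := hf.continuous
    rw [Nat.cast_zero, contDiff_zero]
    exact intervalIntegral.continuous_parametric_intervalIntegral_of_continuous'
      (by fun_prop) 0 1
  | succ n ih =>
    intro k f hf
    have hc := hf.continuous
    have hd : Differentiable ℝ f := hf.differentiable (by simp)
    have hf' : ContDiff ℝ ∞ (deriv f) := (contDiff_infty_iff_deriv.mp hf).2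
    have hc' := hf'.continuous
    have key (x : ℝ) : HasDerivAt (fun x => ∫ t in (0 : ℝ)..1, t ^ k * f (r + t * (x - r)))
        (∫ t in (0 : ℝ)..1, t ^ (k + 1) * deriv f (r + t * (x - r))) x := by
      obtain ⟨M, hM⟩ := ((isCompact_closedBall x 1).prod
        (isCompact_Icc (a := (0 : ℝ)) (b := 1))).exists_bound_of_continuousOn
        (f := fun p : ℝ × ℝ => p.2 ^ (k + 1) * deriv f (r + p.2 * (p.1 - r)))
        (by fun_prop)
      refine (intervalIntegral.hasDerivAt_integral_of_dominated_loc_of_deriv_le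
        (F' := fun x t => t ^ (k + 1) * deriv f (r + t * (x - r))) (bound := fun _ => M)
        (Metric.closedBall_mem_nhds x one_pos) ?_ ?_ ?_ ?_ ?_ ?_).2
      · exact .of_forall fun y => Continuous.aestronglyMeasurable (by fun_prop)
      · exact Continuous.intervalIntegrable (by fun_prop) _ _
      · exact Continuous.aestronglyMeasurable (by fun_prop)
      · refine .of_forall fun t ht y hy => hM (y, t) ⟨hy, ?_⟩
        rw [Set.uIoc_of_le zero_le_one] at ht
        exact Set.Ioc_subset_Icc_self ht
      · simp
      · refine .of_forall fun t _ y _ => ?_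
        have h := ((hd (r + t * (y - r))).hasDerivAt.comp y
          ((((hasDerivAt_id y).sub_const r).const_mul t).const_add r)).const_mul (t ^ k)
        exact h.congr_deriv (by ring)
    rw [Nat.cast_succ, contDiff_succ_iff_deriv]
    refine ⟨fun x => (key x).differentiableAt, by simp, ?_⟩
    rw [funext fun x => (key x).deriv]
    exact ih (k + 1) _ hf'

namespace SmoothRealFunction

/-- The algebra of smooth real functions on the real line. -/
local notation "𝓢" => C^(⊤ : ℕ∞)⟮𝓘(ℝ, ℝ), ℝ; ℝ⟯

/-- The identity function of the real line. -/
local notation "𝓧" => (ContMDiffMap.id : 𝓢)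

theorem id_sub_apply (r y : ℝ) : (𝓧 - algebraMap ℝ 𝓢 r) y = y - r := rfl

/-- **Hadamard's lemma** on the real line. -/
theorem exists_eq_add_id_sub_mul (r : ℝ) (f : 𝓢) :
    ∃ g : 𝓢, f = algebraMap ℝ 𝓢 (f r) + (𝓧 - algebraMap ℝ 𝓢 r) * g := by
  have hf := contMDiff_iff_contDiff.mp f.contMDiff
  have hd : Differentiable ℝ f := hf.differentiable (by simp)
  have hf' := (contDiff_infty_iff_deriv.mp hf).2
  have hc' := hf'.continuous
  refine ⟨⟨fun x => ∫ t in (0 : ℝ)..1, t ^ 0 * deriv f (r + t * (x - r)),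
    (contDiff_infty.mpr fun n =>
      contDiff_integral_pow_mul_comp r n 0 _ hf').contMDiff⟩, ?_⟩
  ext y
  change f y = f r + (y - r) * ∫ t in (0 : ℝ)..1, t ^ 0 * deriv f (r + t * (y - r))
  have h := intervalIntegral.integral_eq_sub_of_hasDerivAt (a := (0 : ℝ)) (b := 1)
    (f := fun t => f (r + t * (y - r)))
    (f' := fun t => (y - r) * (t ^ 0 * deriv f (r + t * (y - r))))
    (fun t _ => ((hd (r + t * (y - r))).hasDerivAt.comp t
        (((hasDerivAt_id t).mul_const (y - r)).const_add r)).congr_deriv (by simp; ring))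
    (Continuous.intervalIntegrable (by fun_prop) _ _)
  rw [← intervalIntegral.integral_const_mul, h]
  simp

/-- Taylor expansion with a smooth remainder. -/
theorem exists_eq_aeval_add_pow_mul (r : ℝ) (N : ℕ) (f : 𝓢) :
    ∃ (P : Polynomial ℝ) (g : 𝓢),
      f = Polynomial.aeval 𝓧 P + (𝓧 - algebraMap ℝ 𝓢 r) ^ N * g := by
  induction N with
  | zero => exact ⟨0, f, by simp⟩
  | succ N ih =>
    obtain ⟨P, g, h⟩ := ih
    obtain ⟨g', hg⟩ := exists_eq_add_id_sub_mul r g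
    refine ⟨P + (.X - .C r) ^ N * .C (g r), g', ?_⟩
    simp only [map_add, map_mul, map_pow, map_sub, Polynomial.aeval_X, Polynomial.aeval_C]
    conv_lhs => rw [h, hg]
    ring

theorem id_sub_mul_left_cancel {r : ℝ} {f g : 𝓢}
    (h : (𝓧 - algebraMap ℝ 𝓢 r) * f = (𝓧 - algebraMap ℝ 𝓢 r) * g) : f = g := by
  apply DFunLike.coe_injective
  refine Continuous.ext_on (dense_compl_singleton r) f.contMDiff.continuous
    g.contMDiff.continuous fun y hy => ?_
  exact mul_left_cancel₀ (sub_ne_zero.mpr hy) (DFunLike.congr_fun h y)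

theorem aeval_id_apply (P : Polynomial ℝ) (y : ℝ) :
    (Polynomial.aeval 𝓧 P : 𝓢) y = P.eval y := by
  induction P using Polynomial.induction_on' with
  | add p q hp hq =>
    rw [map_add, Polynomial.eval_add, ← hp, ← hq]
    rfl
  | monomial n a =>
    rw [Polynomial.aeval_monomial, Polynomial.eval_monomial]
    change a * (𝓧 ^ n : 𝓢) y = a * y ^ n
    rw [ContMDiffMap.coe_pow]
    rfl

theorem X_sub_C_pow_dvd_of_dvd_aeval (r : ℝ) (N : ℕ) (P : Polynomial ℝ)
    (h : (𝓧 - algebraMap ℝ 𝓢 r) ^ N ∣ Polynomial.aeval 𝓧 P) :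
    (Polynomial.X - Polynomial.C r) ^ N ∣ P := by
  induction N generalizing P with
  | zero => simp
  | succ N ih =>
    obtain ⟨g, hg⟩ := h
    rw [pow_succ', mul_assoc] at hg
    have hr : P.IsRoot r := by
      have h := DFunLike.congr_fun hg r
      rw [aeval_id_apply] at h
      exact h.trans (by
        change (r - r) * _ = 0
        rw [sub_self, zero_mul])
    obtain ⟨Q, rfl⟩ := Polynomial.dvd_iff_isRoot.mpr hr
    rw [pow_succ']
    refine mul_dvd_mul_left _ (ih Q ⟨g, id_sub_mul_left_cancel (r := r) ?_⟩)
    simpa using hg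

variable {A : Type*} [CommRing A] [Algebra ℝ A]

/-- A homomorphism out of the smooth functions is determined by its value at the identity, provided
that this value is nilpotent up to a scalar. -/
theorem algHom_ext {r : ℝ} {ξ η : 𝓢 →ₐ[ℝ] A} (h : ξ 𝓧 = η 𝓧)
    (hn : IsNilpotent (ξ 𝓧 - algebraMap ℝ A r)) : ξ = η := by
  obtain ⟨N, hN⟩ := hn
  have hN' : (η 𝓧 - algebraMap ℝ A r) ^ N = 0 := h ▸ hN
  ext f
  obtain ⟨P, g, rfl⟩ := exists_eq_aeval_add_pow_mul r N f
  simp only [map_add, map_mul, map_pow, map_sub, AlgHom.commutes, hN', zero_mul,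
    ← Polynomial.aeval_algHom_apply, h]

theorem exists_algHom_apply_id_eq {r : ℝ} {a : A}
    (hn : IsNilpotent (a - algebraMap ℝ A r)) : ∃ ξ : 𝓢 →ₐ[ℝ] A, ξ 𝓧 = a := by
  obtain ⟨N, hN⟩ := hn
  let I : Ideal 𝓢 := Ideal.span {(𝓧 - algebraMap ℝ 𝓢 r) ^ N}
  let φ : Polynomial ℝ →ₐ[ℝ] 𝓢 ⧸ I := (Ideal.Quotient.mkₐ ℝ I).comp (Polynomial.aeval 𝓧)
  have hφ : Function.Surjective φ := by
    intro q
    obtain ⟨f, rfl⟩ := Ideal.Quotient.mk_surjective q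
    obtain ⟨P, g, h⟩ := exists_eq_aeval_add_pow_mul r N f
    refine ⟨P, Ideal.Quotient.eq.mpr ?_⟩
    rw [← neg_mem_iff, neg_sub]
    exact Ideal.mem_span_singleton.mpr ⟨g, sub_eq_of_eq_add' h⟩
  have hker (P : Polynomial ℝ) (hP : P ∈ RingHom.ker φ) : Polynomial.aeval a P = 0 := by
    have h : Polynomial.aeval 𝓧 P ∈ I := Ideal.Quotient.eq_zero_iff_mem.mp hP
    obtain ⟨Q, rfl⟩ :=
      X_sub_C_pow_dvd_of_dvd_aeval r N P (Ideal.mem_span_singleton.mp h)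
    simp [hN]
  let e := Ideal.quotientKerAlgEquivOfSurjective hφ
  refine ⟨((Ideal.Quotient.liftₐ (RingHom.ker φ) (Polynomial.aeval a) hker).comp
    e.symm.toAlgHom).comp (Ideal.Quotient.mkₐ ℝ I), ?_⟩
  have he : e.symm (Ideal.Quotient.mk I 𝓧) = Ideal.Quotient.mk (RingHom.ker φ) Polynomial.X := by
    rw [AlgEquiv.symm_apply_eq]
    change Ideal.Quotient.mk I 𝓧 = Ideal.Quotient.mk I (Polynomial.aeval 𝓧 Polynomial.X)
    rw [Polynomial.aeval_X]
  change Ideal.Quotient.liftₐ (RingHom.ker φ) (Polynomial.aeval a) hker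
    (e.symm (Ideal.Quotient.mk I 𝓧)) = a
  rw [he]
  exact Polynomial.aeval_X a

end SmoothRealFunction

theorem IsLocalRing.exists_isNilpotent_sub_algebraMap {K A : Type*} [Field K] [CommRing A]
    [Algebra K A] [IsLocalRing A] [FiniteDimensional K A]
    (hcodim : Module.finrank K (A ⧸ IsLocalRing.maximalIdeal A) = 1) (a : A) :
    ∃ r : K, IsNilpotent (a - algebraMap K A r) := by
  obtain ⟨r, hr⟩ := (finrank_eq_one_iff_of_nonzero' (1 : A ⧸ IsLocalRing.maximalIdeal A)
    one_ne_zero).mp hcodim (Ideal.Quotient.mk _ a)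
  have : IsArtinianRing A := IsArtinianRing.of_finite K A
  refine ⟨r, (Ring.KrullDimLE.isNilpotent_iff_mem_maximalIdeal).mpr ?_⟩
  refine Ideal.Quotient.eq.mp ?_
  rw [← hr, ← Algebra.algebraMap_eq_smul_one]
  rfl

/-- Let `A` be a local algebra in the sense of André Weil. Then the map
`Φ` from the set of `ℝ`-algebra homomorphisms `ξ : C^∞(ℝ) → A` to `A` defined by
`Φ(ξ) = ξ(id_ℝ)` is a bijection. This expresses Weil's identification `ℝ^A = A` of the
manifold of infinitely near points of `ℝ` of kind `A` with `A` itself. -/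
theorem weil_points_of_real_line_equiv (A : Type*) [CommRing A] [Algebra ℝ A]
    [IsLocalRing A] [FiniteDimensional ℝ A]
    (hcodim : Module.finrank ℝ (A ⧸ IsLocalRing.maximalIdeal A) = 1) :
    Function.Bijective
      (fun ξ : C^(⊤ : ℕ∞)⟮𝓘(ℝ, ℝ), ℝ; ℝ⟯ →ₐ[ℝ] A => ξ ContMDiffMap.id) := by
  constructor
  · intro ξ η h
    obtain ⟨r, hr⟩ := IsLocalRing.exists_isNilpotent_sub_algebraMap hcodim
      (ξ ContMDiffMap.id)
    exact SmoothRealFunction.algHom_ext h hr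
  · intro a
    obtain ⟨r, hr⟩ := IsLocalRing.exists_isNilpotent_sub_algebraMap hcodim a
    exact SmoothRealFunction.exists_algHom_apply_id_eq hr
end
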